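/- Let μ be a data-generating distribution on ℝⁿ that is linearly separable by a hyperplane (w₀,b₀) ∈ ℝⁿ × ℝ, and assume its support X is bounded. Let Q ∈ ℝ^{m×n} be η-inner-product-preserving over X. Then there exist w* ∈ ℝⁿ and b* ∈ ℝ such that: (i) ⟨w*,x⟩ + b* ≥ 1 for μ⁺-almost every x and ⟨w*,x⟩ + b* ≤ −1 for μ⁻-almost every x; (ii) ‖w*‖ ≤ ‖w₀‖; and (iii) |⟨Qw*,Qx⟩ − ⟨w*,x⟩| ≤ η‖w*‖² for all x ∈ X. -/

import Mathlib

open MeasureTheory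
open scoped RealInnerProductSpace

/-- The support of a Borel measure: points every open neighborhood of which has
positive measure. -/
def measSupport {n : ℕ} (ν : Measure (EuclideanSpace ℝ (Fin n))) :
    Set (EuclideanSpace ℝ (Fin n)) :=
  {x | ∀ U : Set (EuclideanSpace ℝ (Fin n)), IsOpen U → x ∈ U → 0 < ν U}

open scoped Pointwise

lemma measSupport_eq_support {n : ℕ} (ν : Measure (EuclideanSpace ℝ (Fin n))) :
    measSupport ν = ν.support := by
  ext x
  simp only [measSupport, Measure.support_eq_forall_isOpen, Set.mem_ofPred_eq]
  tauto

/-- A closed set contains the support of a measure as soon as it is conull. -/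
lemma mem_of_mem_measSupport {n : ℕ} {ν : Measure (EuclideanSpace ℝ (Fin n))}
    {s : Set (EuclideanSpace ℝ (Fin n))} (hs : IsClosed s) (h : ∀ᵐ x ∂ν, x ∈ s)
    {x : EuclideanSpace ℝ (Fin n)} (hx : x ∈ measSupport ν) : x ∈ s := by
  rw [measSupport_eq_support] at hx
  exact Measure.support_subset_of_isClosed hs h hx

lemma ae_mem_measSupport {n : ℕ} (ν : Measure (EuclideanSpace ℝ (Fin n))) :
    ∀ᵐ x ∂ν, x ∈ measSupport ν := by
  rw [measSupport_eq_support]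
  exact Measure.support_mem_ae

lemma measSupport_nonempty {n : ℕ} (ν : Measure (EuclideanSpace ℝ (Fin n)))
    [IsProbabilityMeasure ν] : (measSupport ν).Nonempty :=
  (ae_mem_measSupport ν).exists

lemma map_mem_of_mem_closedConvexHull {E F : Type*}
    [NormedAddCommGroup E] [NormedSpace ℝ E] [NormedAddCommGroup F] [NormedSpace ℝ F]
    (f : E →L[ℝ] F) {s : Set E} {t : Set F} (ht : Convex ℝ t) (htc : IsClosed t)
    (h : ∀ x ∈ s, f x ∈ t) {x : E} (hx : x ∈ closedConvexHull ℝ s) : f x ∈ t :=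
  closedConvexHull_min (t := f ⁻¹' t) h (ht.linear_preimage f.toLinearMap)
    (htc.preimage f.continuous) hx

/-- A nonempty set in a Hilbert space has a point of minimal norm in its closed convex hull. -/
lemma exists_mem_closedConvexHull_norm_sq_le_inner {E : Type*}
    [NormedAddCommGroup E] [InnerProductSpace ℝ E] [CompleteSpace E]
    {s : Set E} (hs : s.Nonempty) :
    ∃ v ∈ closedConvexHull ℝ s, ∀ x ∈ s, ‖v‖ ^ 2 ≤ ⟪v, x⟫ := by
  obtain ⟨v, hv, hmin⟩ := exists_norm_eq_iInf_of_complete_convex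
    (hs.mono (subset_closedConvexHull (𝕜 := ℝ))) isClosed_closedConvexHull.isComplete
    convex_closedConvexHull (0 : E)
  refine ⟨v, hv, fun x hx => ?_⟩
  have h := (norm_eq_iInf_iff_real_inner_le_zero convex_closedConvexHull hv).1 hmin x
    (subset_closedConvexHull hx)
  rw [zero_sub, inner_neg_left, inner_sub_right, real_inner_self_eq_norm_sq] at h
  linarith

/-- If the gap between two nonempty sets in direction `w` is at least `2`, then an affine
functional with slope `w` separates them with margin `1`. -/
lemma exists_offset_of_two_le_inner_sub {E : Type*}
    [NormedAddCommGroup E] [InnerProductSpace ℝ E] {A B : Set E}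
    (hA : A.Nonempty) (hB : B.Nonempty) {w : E} (h : ∀ x ∈ A, ∀ y ∈ B, 2 ≤ ⟪w, x - y⟫) :
    ∃ b : ℝ, (∀ x ∈ A, 1 ≤ ⟪w, x⟫ + b) ∧ ∀ y ∈ B, ⟪w, y⟫ + b ≤ -1 := by
  have hle : ∀ x ∈ A, ∀ y ∈ B, ⟪w, y⟫ + 2 ≤ ⟪w, x⟫ := fun x hx y hy => by
    have := h x hx y hy
    rw [inner_sub_right] at this
    linarith
  have hbdd : BddBelow ((fun x => ⟪w, x⟫) '' A) := by
    obtain ⟨y, hy⟩ := hB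
    exact ⟨⟪w, y⟫ + 2, Set.forall_mem_image.2 fun x hx => hle x hx y hy⟩
  refine ⟨1 - sInf ((fun x => ⟪w, x⟫) '' A), fun x hx => ?_, fun y hy => ?_⟩
  · linarith [csInf_le hbdd (Set.mem_image_of_mem _ hx)]
  · linarith [le_csInf (hA.image _) (Set.forall_mem_image.2 fun x hx => hle x hx y hy)]

theorem stmt_1 {n m : ℕ}
    (μp μm : Measure (EuclideanSpace ℝ (Fin n)))
    [IsProbabilityMeasure μp] [IsProbabilityMeasure μm]
    (w₀ : EuclideanSpace ℝ (Fin n)) (b₀ : ℝ)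
    (hsepP : ∀ᵐ x ∂μp, ⟪w₀, x⟫ + b₀ ≥ 1)
    (hsepM : ∀ᵐ x ∂μm, ⟪w₀, x⟫ + b₀ ≤ -1)
    (X : Set (EuclideanSpace ℝ (Fin n)))
    (hX : X = measSupport μp ∪ measSupport μm)
    (hbdd : Bornology.IsBounded X)
    (Q : EuclideanSpace ℝ (Fin n) →ₗ[ℝ] EuclideanSpace ℝ (Fin m))
    (η : ℝ)
    (hQ : ∀ x ∈ X, ∀ x' ∈ X, |⟪Q x, Q x'⟫ - ⟪x, x'⟫| ≤ η) :
    ∃ (wstar : EuclideanSpace ℝ (Fin n)) (bstar : ℝ),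
      (∀ᵐ x ∂μp, ⟪wstar, x⟫ + bstar ≥ 1) ∧
      (∀ᵐ x ∂μm, ⟪wstar, x⟫ + bstar ≤ -1) ∧
      ‖wstar‖ ≤ ‖w₀‖ ∧
      (∀ x ∈ X, |⟪Q wstar, Q x⟫ - ⟪wstar, x⟫| ≤ η * ‖wstar‖ ^ 2) := by
  have hP : ∀ x ∈ measSupport μp, 1 ≤ ⟪w₀, x⟫ + b₀ := fun x hx =>
    mem_of_mem_measSupport (s := {x | 1 ≤ ⟪w₀, x⟫ + b₀})
      (isClosed_le (by fun_prop) (by fun_prop)) hsepP hx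
  have hM : ∀ x ∈ measSupport μm, ⟪w₀, x⟫ + b₀ ≤ -1 := fun x hx =>
    mem_of_mem_measSupport (s := {x | ⟪w₀, x⟫ + b₀ ≤ -1})
      (isClosed_le (by fun_prop) (by fun_prop)) hsepM hx
  obtain ⟨v, hv, hvmin⟩ := exists_mem_closedConvexHull_norm_sq_le_inner
    ((measSupport_nonempty μp).sub (measSupport_nonempty μm))
  have hgap : 2 ≤ ⟪w₀, v⟫ :=
    map_mem_of_mem_closedConvexHull (innerSL ℝ w₀) (convex_Ici 2) isClosed_Ici
      (Set.forall_mem_image2.2 fun x hx y hy => by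
        have hx := hP x hx
        have hy := hM y hy
        simp only [innerSL_apply_apply, inner_sub_right, Set.mem_Ici]
        linarith) hv
  have hdist : ∀ x ∈ X, |⟪Q v, Q x⟫ - ⟪v, x⟫| ≤ 2 * η := fun x hx => by
    let f : EuclideanSpace ℝ (Fin n) →L[ℝ] ℝ :=
      (innerSL ℝ (Q x)).comp Q.toContinuousLinearMap - innerSL ℝ x
    have hf : ∀ y, f y = ⟪Q y, Q x⟫ - ⟪y, x⟫ := fun y => by
      simp [f, real_inner_comm]
    have := map_mem_of_mem_closedConvexHull f (convex_Icc (-(2 * η)) (2 * η)) isClosed_Icc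
      (Set.forall_mem_image2.2 fun y hy z hz => by
        have hy := abs_le.1 (hQ y (hX ▸ Or.inl hy) x hx)
        have hz := abs_le.1 (hQ z (hX ▸ Or.inr hz) x hx)
        rw [map_sub, hf, hf]
        constructor <;> linarith) hv
    rw [hf] at this
    exact abs_le.2 this
  have hcs : 2 ≤ ‖w₀‖ * ‖v‖ := hgap.trans (real_inner_le_norm _ _)
  have hv0 : 0 < ‖v‖ := by
    by_contra! h
    nlinarith [norm_nonneg w₀]
  have hnorm : ‖(2 / ‖v‖ ^ 2) • v‖ = 2 / ‖v‖ := by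
    rw [norm_smul, Real.norm_of_nonneg (by positivity)]
    field_simp
  obtain ⟨b, hbP, hbM⟩ := exists_offset_of_two_le_inner_sub (measSupport_nonempty μp)
    (measSupport_nonempty μm) (w := (2 / ‖v‖ ^ 2) • v) fun x hx y hy => by
      rw [real_inner_smul_left, div_mul_eq_mul_div, le_div_iff₀ (by positivity)]
      linarith [hvmin (x - y) (Set.sub_mem_sub hx hy)]
  refine ⟨(2 / ‖v‖ ^ 2) • v, b, (ae_mem_measSupport μp).mono hbP,
    (ae_mem_measSupport μm).mono hbM, ?_, fun x hx => ?_⟩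
  · rwa [hnorm, div_le_iff₀ hv0]
  · rw [hnorm, map_smul, real_inner_smul_left, real_inner_smul_left, ← mul_sub, abs_mul,
      abs_of_pos (by positivity)]
    calc 2 / ‖v‖ ^ 2 * |⟪Q v, Q x⟫ - ⟪v, x⟫| ≤ 2 / ‖v‖ ^ 2 * (2 * η) := by
          gcongr
          exact hdist x hx
      _ = η * (2 / ‖v‖) ^ 2 := by ring
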